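/- arXiv:2108.03638 — 6 statements merged into one kernel-verified Lean document; each statement's English description precedes it below -/
import Mathlib

section
/- Let ι be a finite (nonempty) index type and let x, x' : ι → ℝ satisfy 0 ≤ x' i ≤ x i for all i, and ∑ i, x' i > 0. Then (∏ i, x' i)/(∑ i, x' i) ≤ (∏ i, x i)/(∑ i, x i). (This is the paper's claim that ∏ᵢ xᵢ / ∑ᵢ xᵢ decreases whenever the xᵢ decrease, for any number m of variables.) -/
/-- For a finite nonempty index type `ι`, if `0 ≤ x' i ≤ x i` for all `i` and
`∑ i, x' i > 0`, then `(∏ i, x' i)/(∑ i, x' i) ≤ (∏ i, x i)/(∑ i, x i)`. -/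
theorem prod_div_sum_mono_finite {ι : Type*} [Fintype ι] [Nonempty ι]
    (x x' : ι → ℝ)
    (h0 : ∀ i, 0 ≤ x' i) (hle : ∀ i, x' i ≤ x i)
    (hs : 0 < ∑ i, x' i) :
    (∏ i, x' i) / (∑ i, x' i) ≤ (∏ i, x i) / (∑ i, x i) := by
  classical
  have hs' : 0 < ∑ i, x i := hs.trans_le (Finset.sum_le_sum fun i _ => hle i)
  rw [div_le_div_iff₀ hs hs', Finset.mul_sum, Finset.mul_sum]
  refine Finset.sum_le_sum fun i hi => ?_
  rw [← Finset.mul_prod_erase _ x hi, ← Finset.mul_prod_erase _ x' hi]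
  have hprod : ∏ j ∈ Finset.univ.erase i, x' j ≤ ∏ j ∈ Finset.univ.erase i, x j :=
    Finset.prod_le_prod (fun j _ => h0 j) fun j _ => hle j
  have hmul : 0 ≤ x' i * x i := mul_nonneg (h0 i) ((h0 i).trans (hle i))
  linarith [mul_le_mul_of_nonneg_left hprod hmul]
end

section
/- Let A, B, C be nonempty finite types and let ψ : A × B × C → ℂ be a unit vector (∑ p, ‖ψ p‖² = 1). Let ρ := Matrix.vecMulVec ψ (star ψ), and define the reduced matrices ρ_A a a' = ∑ b, ∑ c, ρ (a,b,c) (a',b,c), ρ_B b b' = ∑ a, ∑ c, ρ (a,b,c) (a,b',c), ρ_C c c' = ∑ a, ∑ b, ρ (a,b,c) (a,b,c'). Then Re(trace (ρ_B * ρ_B)) + Re(trace (ρ_C * ρ_C)) ≤ 1 + Re(trace (ρ_A * ρ_A)). Equivalently, the tangle satisfies the triangle relation τ(ψ^{A|BC}) ≤ τ(ψ^{AB|C}) + τ(ψ^{B|AC}), where τ(ψ^{X|rest}) = 2(1 − trace ρ_X²). (This is the paper's Eq. (10): the triangle relation for the tangle holds with exponent α = 1 for every pure tripartite state of any finite dimension.)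 -/
open scoped ComplexConjugate

namespace TangleTriangle

variable {A B C : Type*}

/-- The (unnormalized) projection of `ψ ⊗ ψ` onto the subspace that is antisymmetric both in the
two copies of `B` and in the two copies of `C`. -/
def doubleAntisymm (ψ : A × B × C → ℂ) (a a' : A) (b b' : B) (c c' : C) : ℂ :=
  ψ (a, b, c) * ψ (a', b', c') - ψ (a, b', c) * ψ (a', b, c')
    - ψ (a, b, c') * ψ (a', b', c) + ψ (a, b', c') * ψ (a', b, c)

theorem doubleAntisymm_swap_left (ψ : A × B × C → ℂ) (a a' : A) (b b' : B) (c c' : C) :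
    doubleAntisymm ψ a a' b' b c c' = -doubleAntisymm ψ a a' b b' c c' := by
  unfold doubleAntisymm; ring

theorem doubleAntisymm_swap_right (ψ : A × B × C → ℂ) (a a' : A) (b b' : B) (c c' : C) :
    doubleAntisymm ψ a a' b b' c' c = -doubleAntisymm ψ a a' b b' c c' := by
  unfold doubleAntisymm; ring

variable [Fintype A] [Fintype B] [Fintype C]

theorem sum_swap_left (f : A → A → B → B → C → C → ℂ) :
    ∑ a, ∑ a', ∑ b, ∑ b', ∑ c, ∑ c', f a a' b' b c c' =
      ∑ a, ∑ a', ∑ b, ∑ b', ∑ c, ∑ c', f a a' b b' c c' :=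
  Finset.sum_congr rfl fun _ _ => Finset.sum_congr rfl fun _ _ => Finset.sum_comm

theorem sum_swap_right (f : A → A → B → B → C → C → ℂ) :
    ∑ a, ∑ a', ∑ b, ∑ b', ∑ c, ∑ c', f a a' b b' c' c =
      ∑ a, ∑ a', ∑ b, ∑ b', ∑ c, ∑ c', f a a' b b' c c' :=
  Finset.sum_congr rfl fun _ _ => Finset.sum_congr rfl fun _ _ =>
    Finset.sum_congr rfl fun _ _ => Finset.sum_congr rfl fun _ _ => Finset.sum_comm

theorem sum_doubleAntisymm_mul_swap_left (ψ : A × B × C → ℂ) (g : A → A → B → B → C → C → ℂ) :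
    ∑ a, ∑ a', ∑ b, ∑ b', ∑ c, ∑ c', doubleAntisymm ψ a a' b b' c c' * g a a' b' b c c' =
      -∑ a, ∑ a', ∑ b, ∑ b', ∑ c, ∑ c', doubleAntisymm ψ a a' b b' c c' * g a a' b b' c c' := by
  rw [← sum_swap_left]
  simp only [← Finset.sum_neg_distrib]
  refine Finset.sum_congr rfl fun _ _ => Finset.sum_congr rfl fun _ _ =>
    Finset.sum_congr rfl fun _ _ => Finset.sum_congr rfl fun _ _ =>
    Finset.sum_congr rfl fun _ _ => Finset.sum_congr rfl fun _ _ => ?_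
  rw [doubleAntisymm_swap_left, neg_mul]

theorem sum_doubleAntisymm_mul_swap_right (ψ : A × B × C → ℂ) (g : A → A → B → B → C → C → ℂ) :
    ∑ a, ∑ a', ∑ b, ∑ b', ∑ c, ∑ c', doubleAntisymm ψ a a' b b' c c' * g a a' b b' c' c =
      -∑ a, ∑ a', ∑ b, ∑ b', ∑ c, ∑ c', doubleAntisymm ψ a a' b b' c c' * g a a' b b' c c' := by
  rw [← sum_swap_right]
  simp only [← Finset.sum_neg_distrib]
  refine Finset.sum_congr rfl fun _ _ => Finset.sum_congr rfl fun _ _ =>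
    Finset.sum_congr rfl fun _ _ => Finset.sum_congr rfl fun _ _ =>
    Finset.sum_congr rfl fun _ _ => Finset.sum_congr rfl fun _ _ => ?_
  rw [doubleAntisymm_swap_right, neg_mul]

/-- The squared norm of `doubleAntisymm ψ` is four times its inner product with `ψ ⊗ ψ`. -/
theorem sum_doubleAntisymm_mul_conj (ψ : A × B × C → ℂ) :
    ∑ a, ∑ a', ∑ b, ∑ b', ∑ c, ∑ c',
        doubleAntisymm ψ a a' b b' c c' * conj (doubleAntisymm ψ a a' b b' c c') =
      4 * ∑ a, ∑ a', ∑ b, ∑ b', ∑ c, ∑ c',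
        doubleAntisymm ψ a a' b b' c c' * conj (ψ (a, b, c) * ψ (a', b', c')) := by
  have h₂ := sum_doubleAntisymm_mul_swap_left ψ fun a a' b b' c c' =>
    conj (ψ (a, b, c) * ψ (a', b', c'))
  have h₃ := sum_doubleAntisymm_mul_swap_right ψ fun a a' b b' c c' =>
    conj (ψ (a, b, c) * ψ (a', b', c'))
  have h₄ := sum_doubleAntisymm_mul_swap_left ψ fun a a' b b' c c' =>
    conj (ψ (a, b, c') * ψ (a', b', c))
  have key : ∀ a a' b b' c c',
      doubleAntisymm ψ a a' b b' c c' * conj (doubleAntisymm ψ a a' b b' c c') =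
        doubleAntisymm ψ a a' b b' c c' * conj (ψ (a, b, c) * ψ (a', b', c'))
        - doubleAntisymm ψ a a' b b' c c' * conj (ψ (a, b', c) * ψ (a', b, c'))
        - doubleAntisymm ψ a a' b b' c c' * conj (ψ (a, b, c') * ψ (a', b', c))
        + doubleAntisymm ψ a a' b b' c c' * conj (ψ (a, b', c') * ψ (a', b, c)) := by
    intro a a' b b' c c'
    simp only [doubleAntisymm, map_add, map_sub]
    ring
  simp only [key, Finset.sum_add_distrib, Finset.sum_sub_distrib]
  linear_combination -h₂ - 2 * h₃ + h₄

theorem re_sum_doubleAntisymm_mul_conj_nonneg (ψ : A × B × C → ℂ) :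
    0 ≤ (∑ a, ∑ a', ∑ b, ∑ b', ∑ c, ∑ c',
      doubleAntisymm ψ a a' b b' c c' * conj (ψ (a, b, c) * ψ (a', b', c'))).re := by
  have h := congrArg Complex.re (sum_doubleAntisymm_mul_conj ψ)
  have h_nonneg : 0 ≤ (∑ a, ∑ a', ∑ b, ∑ b', ∑ c, ∑ c',
      doubleAntisymm ψ a a' b b' c c' * conj (doubleAntisymm ψ a a' b b' c c')).re := by
    simp only [Complex.mul_conj, Complex.re_sum, Complex.ofReal_re]
    repeat' refine Finset.sum_nonneg fun _ _ => ?_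
    exact Complex.normSq_nonneg _
  rw [h] at h_nonneg
  simpa using h_nonneg

theorem sum_eq_sum_prod (f : A → A → B → B → C → C → ℂ) :
    ∑ a, ∑ a', ∑ b, ∑ b', ∑ c, ∑ c', f a a' b b' c c' =
      ∑ p : A × A × B × B × C × C, f p.1 p.2.1 p.2.2.1 p.2.2.2.1 p.2.2.2.2.1 p.2.2.2.2.2 := by
  simp only [Fintype.sum_prod_type]

/-- The norm of `ψ ⊗ ψ`. -/
theorem sum_mul_conj_self (ψ : A × B × C → ℂ) :
    ∑ a, ∑ a', ∑ b, ∑ b', ∑ c, ∑ c',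
        ψ (a, b, c) * ψ (a', b', c') * conj (ψ (a, b, c) * ψ (a', b', c')) =
      (∑ p, ψ p * conj (ψ p)) * ∑ p, ψ p * conj (ψ p) := by
  rw [sum_eq_sum_prod, Finset.sum_mul_sum, ← Fintype.sum_prod_type']
  refine Fintype.sum_equiv
    { toFun := fun (a, a', b, b', c, c') => ((a, b, c), (a', b', c'))
      invFun := fun ((a, b, c), (a', b', c')) => (a, a', b, b', c, c')
      left_inv := fun _ => rfl
      right_inv := fun _ => rfl } _ _ fun p => ?_
  simp only [map_mul, Equiv.coe_fn_mk]
  ring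

/-- The purity of the reduced state on `B`. -/
theorem sum_swap_left_mul_conj (ψ : A × B × C → ℂ) :
    ∑ a, ∑ a', ∑ b, ∑ b', ∑ c, ∑ c',
        ψ (a, b', c) * ψ (a', b, c') * conj (ψ (a, b, c) * ψ (a', b', c')) =
      ∑ b, ∑ b', (∑ a, ∑ c, ψ (a, b, c) * conj (ψ (a, b', c))) *
        ∑ a, ∑ c, ψ (a, b', c) * conj (ψ (a, b, c)) := by
  rw [sum_eq_sum_prod]
  let e : A × A × B × B × C × C ≃ B × B × A × C × A × C :=
    { toFun := fun (a, a', b, b', c, c') => (b, b', a, c, a', c')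
      invFun := fun (b, b', a, c, a', c') => (a, a', b, b', c, c')
      left_inv := fun _ => rfl
      right_inv := fun _ => rfl }
  rw [← e.symm.sum_comp]
  simp only [Fintype.sum_prod_type, Finset.sum_mul, Finset.mul_sum]
  refine Finset.sum_congr rfl fun _ _ => Finset.sum_congr rfl fun _ _ =>
    Finset.sum_congr rfl fun _ _ => Finset.sum_congr rfl fun _ _ =>
    Finset.sum_congr rfl fun _ _ => Finset.sum_congr rfl fun _ _ => ?_
  simp only [e, Equiv.coe_fn_symm_mk, map_mul]
  ring

/-- The purity of the reduced state on `C`. -/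
theorem sum_swap_right_mul_conj (ψ : A × B × C → ℂ) :
    ∑ a, ∑ a', ∑ b, ∑ b', ∑ c, ∑ c',
        ψ (a, b, c') * ψ (a', b', c) * conj (ψ (a, b, c) * ψ (a', b', c')) =
      ∑ c, ∑ c', (∑ a, ∑ b, ψ (a, b, c) * conj (ψ (a, b, c'))) *
        ∑ a, ∑ b, ψ (a, b, c') * conj (ψ (a, b, c)) := by
  rw [sum_eq_sum_prod]
  let e : A × A × B × B × C × C ≃ C × C × A × B × A × B :=
    { toFun := fun (a, a', b, b', c, c') => (c, c', a, b, a', b')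
      invFun := fun (c, c', a, b, a', b') => (a, a', b, b', c, c')
      left_inv := fun _ => rfl
      right_inv := fun _ => rfl }
  rw [← e.symm.sum_comp]
  simp only [Fintype.sum_prod_type, Finset.sum_mul, Finset.mul_sum]
  refine Finset.sum_congr rfl fun _ _ => Finset.sum_congr rfl fun _ _ =>
    Finset.sum_congr rfl fun _ _ => Finset.sum_congr rfl fun _ _ =>
    Finset.sum_congr rfl fun _ _ => Finset.sum_congr rfl fun _ _ => ?_
  simp only [e, Equiv.coe_fn_symm_mk, map_mul]
  ring

/-- The purity of the reduced state on `A`. -/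
theorem sum_swap_both_mul_conj (ψ : A × B × C → ℂ) :
    ∑ a, ∑ a', ∑ b, ∑ b', ∑ c, ∑ c',
        ψ (a, b', c') * ψ (a', b, c) * conj (ψ (a, b, c) * ψ (a', b', c')) =
      ∑ a, ∑ a', (∑ b, ∑ c, ψ (a, b, c) * conj (ψ (a', b, c))) *
        ∑ b, ∑ c, ψ (a', b, c) * conj (ψ (a, b, c)) := by
  rw [sum_eq_sum_prod]
  let e : A × A × B × B × C × C ≃ A × A × B × C × B × C :=
    { toFun := fun (a, a', b, b', c, c') => (a, a', b, c, b', c')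
      invFun := fun (a, a', b, c, b', c') => (a, a', b, b', c, c')
      left_inv := fun _ => rfl
      right_inv := fun _ => rfl }
  rw [← e.symm.sum_comp]
  simp only [Fintype.sum_prod_type, Finset.sum_mul, Finset.mul_sum]
  refine Finset.sum_congr rfl fun _ _ => Finset.sum_congr rfl fun _ _ =>
    Finset.sum_congr rfl fun _ _ => Finset.sum_congr rfl fun _ _ =>
    Finset.sum_congr rfl fun _ _ => Finset.sum_congr rfl fun _ _ => ?_
  simp only [e, Equiv.coe_fn_symm_mk, map_mul]
  ring

end TangleTriangle

open TangleTriangle in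
/-- For any tripartite pure state `ψ`, the tangle satisfies the triangle relation
`τ(A|BC) ≤ τ(AB|C) + τ(B|AC)`, phrased as
`Re(tr ρ_B²) + Re(tr ρ_C²) ≤ 1 + Re(tr ρ_A²)`. -/
theorem tangle_triangle {A B C : Type*}
    [Fintype A] [Fintype B] [Fintype C] [Nonempty A] [Nonempty B] [Nonempty C]
    (ψ : A × B × C → ℂ) (hψ : ∑ p, ‖ψ p‖ ^ 2 = 1)
    (ρ : Matrix (A × B × C) (A × B × C) ℂ)
    (hρ : ρ = Matrix.vecMulVec ψ (star ψ))
    (ρA : Matrix A A ℂ)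
    (hρA : ∀ a a', ρA a a' = ∑ b, ∑ c, ρ (a, b, c) (a', b, c))
    (ρB : Matrix B B ℂ)
    (hρB : ∀ b b', ρB b b' = ∑ a, ∑ c, ρ (a, b, c) (a, b', c))
    (ρC : Matrix C C ℂ)
    (hρC : ∀ c c', ρC c c' = ∑ a, ∑ b, ρ (a, b, c) (a, b, c')) :
    (Matrix.trace (ρB * ρB)).re + (Matrix.trace (ρC * ρC)).re ≤
      1 + (Matrix.trace (ρA * ρA)).re := by
  have h := re_sum_doubleAntisymm_mul_conj_nonneg ψ
  have h_unit : ∑ p, ψ p * conj (ψ p) = 1 := by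
    simp only [Complex.mul_conj, Complex.normSq_eq_norm_sq]
    exact_mod_cast hψ
  simp only [doubleAntisymm, add_mul, sub_mul, Finset.sum_add_distrib, Finset.sum_sub_distrib] at h
  rw [sum_mul_conj_self, sum_swap_left_mul_conj, sum_swap_right_mul_conj,
    sum_swap_both_mul_conj, h_unit] at h
  simp only [Matrix.trace, Matrix.diag_apply, Matrix.mul_apply, hρA, hρB, hρC, hρ,
    Matrix.vecMulVec_apply, Pi.star_apply, RCLike.star_def]
  simp only [Complex.add_re, Complex.sub_re, mul_one, Complex.one_re] at h
  linarith
end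

section
/- Let B and C be nonempty finite types and let ρ : Matrix (B × C) (B × C) ℂ be positive semidefinite with trace ρ = 1. Define the reduced matrices ρ_B : Matrix B B ℂ by ρ_B b b' = ∑ c, ρ (b,c) (b',c) and ρ_C : Matrix C C ℂ by ρ_C c c' = ∑ b, ρ (b,c) (b,c'). Then Re(trace (ρ_B * ρ_B)) + Re(trace (ρ_C * ρ_C)) ≤ 1 + Re(trace (ρ * ρ)). (This is the subadditivity-of-purities inequality 1 + Tr(ρ^{BC})² ≥ Tr(ρ^B)² + Tr(ρ^C)², which the paper invokes to establish the tangle triangle relation.) -/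
open scoped ComplexOrder

open Matrix Kronecker in
/-- The quadratic form of `ρ ⊗ ρ` is nonnegative at the antisymmetrization, in both tensor factors,
of a product basis vector. -/
theorem Matrix.PosSemidef.kronecker_self_antisymm_nonneg {B C : Type*} [Finite B] [Finite C]
    {ρ : Matrix (B × C) (B × C) ℂ} (hρ : ρ.PosSemidef)
    (T : B → B → C → C → ℂ)
    (hT : ∀ b b' c c', T b b' c c' =
      ρ (b, c) (b, c) * ρ (b', c') (b', c') - ρ (b, c) (b', c) * ρ (b', c') (b, c')
        - ρ (b, c) (b, c') * ρ (b', c') (b', c) + ρ (b, c) (b', c') * ρ (b', c') (b, c))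
    (b b' : B) (c c' : C) :
    0 ≤ T b b' c c' + T b' b c c' + T b b' c' c + T b' b c' c := by
  have h := ((hρ.kronecker hρ).submatrix
    ![((b, c), (b', c')), ((b', c), (b, c')), ((b, c'), (b', c)), ((b', c'), (b, c))]
    ).dotProduct_mulVec_nonneg ![1, -1, -1, 1]
  simp only [dotProduct, mulVec, Fin.sum_univ_four, submatrix_apply, kroneckerMap_apply,
    Pi.star_apply, Matrix.cons_val, star_one, star_neg] at h
  simp only [hT]
  convert h using 1
  ring

/-- Subadditivity of purities: for a bipartite density matrix `ρ` on `B × C`,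
`Re(tr ρ_B²) + Re(tr ρ_C²) ≤ 1 + Re(tr ρ²)`. -/
theorem purity_subadditive {B C : Type*}
    [Fintype B] [Fintype C] [Nonempty B] [Nonempty C]
    (ρ : Matrix (B × C) (B × C) ℂ)
    (hρ : ρ.PosSemidef) (htr : Matrix.trace ρ = 1)
    (ρB : Matrix B B ℂ)
    (hρB : ∀ b b', ρB b b' = ∑ c, ρ (b, c) (b', c))
    (ρC : Matrix C C ℂ)
    (hρC : ∀ c c', ρC c c' = ∑ b, ρ (b, c) (b, c')) :
    (Matrix.trace (ρB * ρB)).re + (Matrix.trace (ρC * ρC)).re ≤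
      1 + (Matrix.trace (ρ * ρ)).re := by
  set T : B → B → C → C → ℂ := fun b b' c c' =>
      ρ (b, c) (b, c) * ρ (b', c') (b', c') - ρ (b, c) (b', c) * ρ (b', c') (b, c')
        - ρ (b, c) (b, c') * ρ (b', c') (b', c) + ρ (b, c) (b', c') * ρ (b', c') (b, c) with hT
  have hnonneg : 0 ≤ ∑ b, ∑ b', ∑ c, ∑ c',
      (T b b' c c' + T b' b c c' + T b b' c' c + T b' b c' c) :=
    Finset.sum_nonneg fun b _ => Finset.sum_nonneg fun b' _ => Finset.sum_nonneg fun c _ =>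
      Finset.sum_nonneg fun c' _ =>
        hρ.kronecker_self_antisymm_nonneg T (fun _ _ _ _ => rfl) b b' c c'
  have hswapB : ∑ b, ∑ b', ∑ c, ∑ c', T b' b c c' = ∑ b, ∑ b', ∑ c, ∑ c', T b b' c c' :=
    Finset.sum_comm
  have hswapC : ∑ b, ∑ b', ∑ c, ∑ c', T b b' c' c = ∑ b, ∑ b', ∑ c, ∑ c', T b b' c c' :=
    Finset.sum_congr rfl fun b _ => Finset.sum_congr rfl fun b' _ => Finset.sum_comm
  have hswapBC : ∑ b, ∑ b', ∑ c, ∑ c', T b' b c' c = ∑ b, ∑ b', ∑ c, ∑ c', T b b' c c' :=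
    Finset.sum_comm.trans hswapC
  have htr_sq : ∑ b, ∑ b', ∑ c, ∑ c', ρ (b, c) (b, c) * ρ (b', c') (b', c') = 1 := by
    rw [← one_mul (1 : ℂ), ← htr]
    simp only [Matrix.trace, Matrix.diag, Fintype.sum_prod_type, Finset.sum_mul_sum]
  have hB : ∑ b, ∑ b', ∑ c, ∑ c', ρ (b, c) (b', c) * ρ (b', c') (b, c') =
      Matrix.trace (ρB * ρB) := by
    simp only [Matrix.trace, Matrix.diag, Matrix.mul_apply, hρB, Finset.sum_mul_sum]
  have hC : ∑ b, ∑ b', ∑ c, ∑ c', ρ (b, c) (b, c') * ρ (b', c') (b', c) =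
      Matrix.trace (ρC * ρC) := by
    have hcomm := Finset.sum_comm (s := Finset.univ) (t := Finset.univ)
      (f := fun (p : B × B) (q : C × C) => ρ (p.1, q.1) (p.1, q.2) * ρ (p.2, q.2) (p.2, q.1))
    simp only [Fintype.sum_prod_type] at hcomm
    simp only [Matrix.trace, Matrix.diag, Matrix.mul_apply, hρC, Finset.sum_mul_sum, hcomm]
  have hBC : ∑ b, ∑ b', ∑ c, ∑ c', ρ (b, c) (b', c') * ρ (b', c') (b, c) =
      Matrix.trace (ρ * ρ) := by
    simp only [Matrix.trace, Matrix.diag, Matrix.mul_apply, Fintype.sum_prod_type]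
    exact Finset.sum_congr rfl fun b _ => Finset.sum_comm
  have hsum : ∑ b, ∑ b', ∑ c, ∑ c', T b b' c c' =
      1 - Matrix.trace (ρB * ρB) - Matrix.trace (ρC * ρC) + Matrix.trace (ρ * ρ) := by
    simp only [hT, Finset.sum_add_distrib, Finset.sum_sub_distrib, htr_sq, hB, hC, hBC]
  simp only [Finset.sum_add_distrib, hswapB, hswapC, hswapBC, hsum] at hnonneg
  have hre := (Complex.le_def.mp hnonneg).1
  simp only [Complex.add_re, Complex.sub_re, Complex.one_re, Complex.zero_re] at hre
  linarith
end

section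
/- Let A and B be nonempty finite types and let ψ : A × B → ℂ be a unit vector (∑ p, ‖ψ p‖² = 1). Let ρ := Matrix.vecMulVec ψ (star ψ) and let ρ_A a a' = ∑ b, ρ (a,b) (a',b) be the reduced matrix on A. If trace (ρ_A * ρ_A) = 1, then there exist vectors u : A → ℂ and v : B → ℂ such that ψ (a, b) = u a · v b for all a, b. (This is the fact, used throughout the paper, that a pure bipartite state whose reduced state is pure — equivalently whose tangle τ = 2(1 − trace ρ_A²) vanishes — is a product state across that bipartition.) -/
open ComplexConjugate in
/-- Lagrange's identity: the squared moduli of the `2 × 2` minors of `M` sum to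
`2 ((tr M Mᴴ)² - tr (M Mᴴ)²)`. -/
theorem sum_minor_mul_conj {A B : Type*} [Fintype A] [Fintype B] (M : A → B → ℂ) :
    ∑ a, ∑ a', ∑ b, ∑ b', (M a b * M a' b' - M a b' * M a' b) *
        conj (M a b * M a' b' - M a b' * M a' b) =
      2 * ((∑ a, ∑ b, M a b * conj (M a b)) * (∑ a, ∑ b, M a b * conj (M a b)) -
        ∑ a, ∑ a', (∑ b, M a b * conj (M a' b)) * (∑ b, M a' b * conj (M a b))) := by
  have h (a a' : A) : ∑ b, ∑ b', (M a b * M a' b' - M a b' * M a' b) *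
        conj (M a b * M a' b' - M a b' * M a' b) =
      2 * ((∑ b, M a b * conj (M a b)) * (∑ b, M a' b * conj (M a' b)) -
        (∑ b, M a b * conj (M a' b)) * (∑ b, M a' b * conj (M a b))) := by
    have expand (b b' : B) : (M a b * M a' b' - M a b' * M a' b) *
          conj (M a b * M a' b' - M a b' * M a' b) =
        (M a b * conj (M a b)) * (M a' b' * conj (M a' b')) +
        (M a' b * conj (M a' b)) * (M a b' * conj (M a b')) -
        (M a b * conj (M a' b)) * (M a' b' * conj (M a b')) -
        (M a' b * conj (M a b)) * (M a b' * conj (M a' b')) := by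
      simp only [map_sub, map_mul]
      ring
    simp only [expand, Finset.sum_sub_distrib, Finset.sum_add_distrib, ← Finset.sum_mul_sum]
    ring
  simp only [h, ← Finset.mul_sum, Finset.sum_sub_distrib, ← Finset.sum_mul]

open ComplexConjugate in
/-- If `tr (M Mᴴ)² = (tr M Mᴴ)²`, then all `2 × 2` minors of `M` vanish. -/
theorem minor_eq_zero_of_trace_sq_eq {A B : Type*} [Fintype A] [Fintype B] (M : A → B → ℂ)
    (h : ∑ a, ∑ a', (∑ b, M a b * conj (M a' b)) * (∑ b, M a' b * conj (M a b)) =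
      (∑ a, ∑ b, M a b * conj (M a b)) * (∑ a, ∑ b, M a b * conj (M a b)))
    (a a' : A) (b b' : B) : M a b * M a' b' = M a b' * M a' b := by
  have key := sum_minor_mul_conj M
  rw [h, sub_self, mul_zero] at key
  simp only [Complex.mul_conj'] at key
  norm_cast at key
  rw [Finset.sum_eq_zero_iff_of_nonneg (fun _ _ => by positivity)] at key
  have key := key a (Finset.mem_univ _)
  rw [Finset.sum_eq_zero_iff_of_nonneg (fun _ _ => by positivity)] at key
  have key := key a' (Finset.mem_univ _)
  rw [Finset.sum_eq_zero_iff_of_nonneg (fun _ _ => by positivity)] at key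
  have key := key b (Finset.mem_univ _)
  rw [Finset.sum_eq_zero_iff_of_nonneg (fun _ _ => by positivity)] at key
  have key := key b' (Finset.mem_univ _)
  exact sub_eq_zero.mp (norm_eq_zero.mp (pow_eq_zero_iff two_ne_zero |>.mp key))

/-- A bipartite pure state whose reduced state is pure (purity `tr ρ_A² = 1`)
is a product state: `ψ (a,b) = u a * v b`. -/
theorem product_of_pure_reduced {A B : Type*}
    [Fintype A] [Fintype B] [Nonempty A] [Nonempty B]
    (ψ : A × B → ℂ) (hψ : ∑ p, ‖ψ p‖ ^ 2 = 1)
    (ρ : Matrix (A × B) (A × B) ℂ)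
    (hρ : ρ = Matrix.vecMulVec ψ (star ψ))
    (ρA : Matrix A A ℂ)
    (hρA : ∀ a a', ρA a a' = ∑ b, ρ (a, b) (a', b))
    (hpure : Matrix.trace (ρA * ρA) = 1) :
    ∃ (u : A → ℂ) (v : B → ℂ), ∀ a b, ψ (a, b) = u a * v b := by
  have hnorm : ∑ a, ∑ b, ψ (a, b) * (starRingEnd ℂ) (ψ (a, b)) = 1 := by
    simp only [Complex.mul_conj']
    rw [← Fintype.sum_prod_type' (fun a b => (‖ψ (a, b)‖ : ℂ) ^ 2)]
    exact_mod_cast hψ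
  have hminor := minor_eq_zero_of_trace_sq_eq (fun a b => ψ (a, b)) (by
    rw [hnorm, one_mul, ← hpure]
    simp [Matrix.trace, Matrix.mul_apply, hρA, hρ, Matrix.vecMulVec_apply])
  obtain ⟨⟨a₀, b₀⟩, h₀⟩ : ∃ p, ψ p ≠ 0 := by
    by_contra! h
    simp [h] at hψ
  refine ⟨fun a => ψ (a, b₀), fun b => ψ (a₀, b) / ψ (a₀, b₀), fun a b => ?_⟩
  rw [← mul_div_assoc, eq_div_iff h₀]
  exact hminor a a₀ b b₀
end

section
/- Let A, B, C, D be nonempty finite types, let φ : A × D → ℂ, β : B → ℂ, γ : C → ℂ be unit vectors, and define the unit vector ψ : A × B × C × D → ℂ by ψ (a,b,c,d) = φ (a,d) · β b · γ c. Let ρ := Matrix.vecMulVec ψ (star ψ), and define the reduced matrices ρ_B (on B), ρ_C (on C), ρ_{CD} (on C × D), ρ_{BD} (on B × D) by summing the remaining indices diagonally, e.g. ρ_{CD} (c,d) (c',d') = ∑ a, ∑ b, ρ (a,b,c,d) (a,b,c',d'). Then trace (ρ_B * ρ_B) + trace (ρ_{CD} * ρ_{CD}) = trace (ρ_{BD}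 * ρ_{BD}) + trace (ρ_C * ρ_C); equivalently, the tripartite tangles agree: τ⁽³⁾(ψ^{A|B|CD}) = τ⁽³⁾(ψ^{A|BD|C}), where τ⁽³⁾(X|Y|Z) := 3 − trace ρ_X² − trace ρ_Y² − trace ρ_Z². (This is the tangle instance of Proposition 1: if the tripartite entanglement across AD|B|C vanishes, the two tripartitions A|B|CD and A|BD|C carry equal entanglement.) -/
theorem dotProduct_star_self_eq_one {ι : Type*} [Fintype ι] {v : ι → ℂ}
    (hv : ∑ i, ‖v i‖ ^ 2 = 1) : v ⬝ᵥ star v = 1 := by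
  have h : ((∑ i, ‖v i‖ ^ 2 : ℝ) : ℂ) = 1 := by rw [hv, Complex.ofReal_one]
  simpa [dotProduct, Complex.mul_conj'] using h

/-- A pure state has purity one. -/
theorem trace_vecMulVec_star_mul_self {ι : Type*} [Fintype ι] {v : ι → ℂ}
    (hv : ∑ i, ‖v i‖ ^ 2 = 1) :
    Matrix.trace (Matrix.vecMulVec v (star v) * Matrix.vecMulVec v (star v)) = 1 := by
  have h := dotProduct_star_self_eq_one hv
  rw [Matrix.vecMulVec_mul_vecMulVec, dotProduct_comm (star v) v, h, one_smul,
    Matrix.trace_vecMulVec, h]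

open scoped Kronecker in
/-- Tensoring with a pure state does not change the purity. -/
theorem trace_vecMulVec_star_kronecker_mul_self {ι κ : Type*} [Fintype ι] [Fintype κ]
    {v : ι → ℂ} (hv : ∑ i, ‖v i‖ ^ 2 = 1) (M : Matrix κ κ ℂ) :
    Matrix.trace ((Matrix.vecMulVec v (star v) ⊗ₖ M) * (Matrix.vecMulVec v (star v) ⊗ₖ M)) =
      Matrix.trace (M * M) := by
  rw [← Matrix.mul_kronecker_mul, Matrix.trace_kronecker, trace_vecMulVec_star_mul_self hv,
    one_mul]

/-- For a four-partite pure state of the form `ψ (a,b,c,d) = φ (a,d) * β b * γ c`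
(vanishing tripartite entanglement across `AD|B|C`), the tripartite tangles of the
tripartitions `A|B|CD` and `A|BD|C` agree:
`tr ρ_B² + tr ρ_CD² = tr ρ_BD² + tr ρ_C²`. -/
theorem tripartite_tangle_eq_of_factorized {A B C D : Type*}
    [Fintype A] [Fintype B] [Fintype C] [Fintype D]
    [Nonempty A] [Nonempty B] [Nonempty C] [Nonempty D]
    (φ : A × D → ℂ) (β : B → ℂ) (γ : C → ℂ)
    (hφ : ∑ p, ‖φ p‖ ^ 2 = 1) (hβ : ∑ b, ‖β b‖ ^ 2 = 1) (hγ : ∑ c, ‖γ c‖ ^ 2 = 1)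
    (ψ : A × B × C × D → ℂ)
    (hψ : ∀ a b c d, ψ (a, b, c, d) = φ (a, d) * β b * γ c)
    (ρ : Matrix (A × B × C × D) (A × B × C × D) ℂ)
    (hρ : ρ = Matrix.vecMulVec ψ (star ψ))
    (ρB : Matrix B B ℂ)
    (hρB : ∀ b b', ρB b b' = ∑ a, ∑ c, ∑ d, ρ (a, b, c, d) (a, b', c, d))
    (ρC : Matrix C C ℂ)
    (hρC : ∀ c c', ρC c c' = ∑ a, ∑ b, ∑ d, ρ (a, b, c, d) (a, b, c', d))
    (ρCD : Matrix (C × D) (C × D) ℂ)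
    (hρCD : ∀ c d c' d',
      ρCD (c, d) (c', d') = ∑ a, ∑ b, ρ (a, b, c, d) (a, b, c', d'))
    (ρBD : Matrix (B × D) (B × D) ℂ)
    (hρBD : ∀ b d b' d',
      ρBD (b, d) (b', d') = ∑ a, ∑ c, ρ (a, b, c, d) (a, b', c, d')) :
    Matrix.trace (ρB * ρB) + Matrix.trace (ρCD * ρCD) =
      Matrix.trace (ρBD * ρBD) + Matrix.trace (ρC * ρC) := by
  have hφ' : ∑ a, ∑ d, φ (a, d) * star (φ (a, d)) = 1 := by
    have h := dotProduct_star_self_eq_one hφ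
    rwa [dotProduct, Fintype.sum_prod_type] at h
  have hβ' : ∑ b, β b * star (β b) = 1 := dotProduct_star_self_eq_one hβ
  have hγ' : ∑ c, γ c * star (γ c) = 1 := dotProduct_star_self_eq_one hγ
  have hρ_apply : ∀ a b c d a' b' c' d', ρ (a, b, c, d) (a', b', c', d') =
      φ (a, d) * β b * γ c * star (φ (a', d') * β b' * γ c') := by
    intro a b c d a' b' c' d'
    rw [hρ, Matrix.vecMulVec_apply, Pi.star_apply, hψ, hψ]
  have hB : ρB = Matrix.vecMulVec β (star β) := by
    ext b b'
    calc ρB b b' = ∑ a, ∑ c, ∑ d, β b * star (β b') *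
          ((φ (a, d) * star (φ (a, d))) * (γ c * star (γ c))) := by
          simp only [hρB, hρ_apply, star_mul']
          exact Finset.sum_congr rfl fun _ _ ↦ Finset.sum_congr rfl fun _ _ ↦
            Finset.sum_congr rfl fun _ _ ↦ by ring
      _ = β b * star (β b') := by
          simp only [← Finset.mul_sum, ← Finset.sum_mul, hγ', hφ', mul_one]
  have hC : ρC = Matrix.vecMulVec γ (star γ) := by
    ext c c'
    calc ρC c c' = ∑ a, ∑ b, ∑ d, γ c * star (γ c') *
          ((φ (a, d) * star (φ (a, d))) * (β b * star (β b))) := by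
          simp only [hρC, hρ_apply, star_mul']
          exact Finset.sum_congr rfl fun _ _ ↦ Finset.sum_congr rfl fun _ _ ↦
            Finset.sum_congr rfl fun _ _ ↦ by ring
      _ = γ c * star (γ c') := by
          simp only [← Finset.mul_sum, ← Finset.sum_mul, hβ', hφ', mul_one]
  let M : Matrix D D ℂ := Matrix.of fun d d' ↦ ∑ a, φ (a, d) * star (φ (a, d'))
  have hCD : ρCD = Matrix.kroneckerMap (· * ·) (Matrix.vecMulVec γ (star γ)) M := by
    ext ⟨c, d⟩ ⟨c', d'⟩
    calc ρCD (c, d) (c', d') = ∑ a, ∑ b, γ c * star (γ c') *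
          ((φ (a, d) * star (φ (a, d'))) * (β b * star (β b))) := by
          simp only [hρCD, hρ_apply, star_mul']
          exact Finset.sum_congr rfl fun _ _ ↦ Finset.sum_congr rfl fun _ _ ↦ by ring
      _ = γ c * star (γ c') * ∑ a, φ (a, d) * star (φ (a, d')) := by
          simp only [← Finset.mul_sum, hβ', mul_one]
  have hBD : ρBD = Matrix.kroneckerMap (· * ·) (Matrix.vecMulVec β (star β)) M := by
    ext ⟨b, d⟩ ⟨b', d'⟩
    calc ρBD (b, d) (b', d') = ∑ a, ∑ c, β b * star (β b') *
          ((φ (a, d) * star (φ (a, d'))) * (γ c * star (γ c))) := by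
          simp only [hρBD, hρ_apply, star_mul']
          exact Finset.sum_congr rfl fun _ _ ↦ Finset.sum_congr rfl fun _ _ ↦ by ring
      _ = β b * star (β b') * ∑ a, φ (a, d) * star (φ (a, d')) := by
          simp only [← Finset.mul_sum, hγ', mul_one]
  rw [hB, hC, hCD, hBD, trace_vecMulVec_star_mul_self hβ, trace_vecMulVec_star_mul_self hγ,
    trace_vecMulVec_star_kronecker_mul_self hγ, trace_vecMulVec_star_kronecker_mul_self hβ,
    add_comm]
end

section
/- Let A, B, C, D be nonempty finite types and let ψ : (A × B) × (C × D) → ℂ be a unit vector (∑ p, ‖ψ p‖² = 1). Let ρ := Matrix.vecMulVec ψ (star ψ). Define the reduced matrices ρ_{AB} (a,b) (a',b') = ∑ c, ∑ d, ρ ((a,b),(c,d)) ((a',b'),(c,d)), ρ_{AC} (a,c) (a',c') = ∑ b, ∑ d, ρ ((a,b),(c,d)) ((a',b),(c',d)), and ρ_{AD} (a,d) (a',d') = ∑ b, ∑ c, ρ ((a,b),(c,d)) ((a',b),(c,d')). If trace (ρ_{AB} * ρ_{AB}) = 1, then trace (ρ_{AC} * ρ_{AC}) = trace (ρ_{AD}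 * ρ_{AD}); equivalently, if τ(ψ^{AB|CD}) = 0 then τ(ψ^{AC|BD}) = τ(ψ^{AD|BC}), where τ across a bipartition X|Y is 2(1 − trace ρ_X²). (This is the tangle instance of Proposition 2: for a four-partite pure state factorizing across AB|CD, the entanglements across AC|BD and AD|BC coincide.) -/
/-- A unit vector on `X × Y` whose reduced matrix on `X` has purity one has vanishing
`2 × 2` minors, i.e. it is a product vector. -/
theorem mul_eq_mul_swap_of_pure {X Y : Type*} [Fintype X] [Fintype Y] (M : X × Y → ℂ)
    (hM : ∑ p, ‖M p‖ ^ 2 = 1)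
    (hpure : ∑ x, ∑ x', (∑ y, M (x, y) * star (M (x', y))) *
      (∑ y, M (x', y) * star (M (x, y))) = 1) (x x' : X) (y y' : Y) :
    M (x, y) * M (x', y') = M (x, y') * M (x', y) := by
  have hM' : ∑ x, ∑ y, M (x, y) * star (M (x, y)) = 1 := by
    rw [← Fintype.sum_prod_type' (f := fun x y => M (x, y) * star (M (x, y)))]
    have h := congrArg (fun r : ℝ => (r : ℂ)) hM
    simpa [Complex.mul_conj'] using h
  have hN : ∑ x, ∑ x', ∑ y, ∑ y', (M (x, y) * star (M (x, y))) *
      (M (x', y') * star (M (x', y'))) = 1 := by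
    simp only [← Finset.sum_mul_sum, hM', mul_one]
  have hN' : ∑ x, ∑ x', ∑ y, ∑ y', (M (x, y') * star (M (x, y'))) *
      (M (x', y) * star (M (x', y))) = 1 := by
    rw [← hN]
    exact Finset.sum_congr rfl fun _ _ => Finset.sum_congr rfl fun _ _ => Finset.sum_comm
  have hT : ∑ x, ∑ x', ∑ y, ∑ y', (M (x, y) * star (M (x', y))) *
      (M (x', y') * star (M (x, y'))) = 1 := by
    simpa only [← Finset.sum_mul_sum] using hpure
  have hT' : ∑ x, ∑ x', ∑ y, ∑ y', (M (x, y') * star (M (x', y'))) *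
      (M (x', y) * star (M (x, y))) = 1 := by
    rw [← hT]
    exact Finset.sum_congr rfl fun _ _ => Finset.sum_congr rfl fun _ _ => Finset.sum_comm
  have hminors : ∑ x, ∑ x', ∑ y, ∑ y',
      ‖M (x, y) * M (x', y') - M (x, y') * M (x', y)‖ ^ 2 = 0 := by
    have hzero : ∑ x, ∑ x', ∑ y, ∑ y',
        (M (x, y) * M (x', y') - M (x, y') * M (x', y)) *
          star (M (x, y) * M (x', y') - M (x, y') * M (x', y)) = (1 + 1 - 1 - 1 : ℂ) := by
      nth_rewrite 1 [← hN]
      nth_rewrite 1 [← hN']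
      nth_rewrite 1 [← hT]
      nth_rewrite 1 [← hT']
      simp only [← Finset.sum_add_distrib, ← Finset.sum_sub_distrib]
      refine Finset.sum_congr rfl fun _ _ => Finset.sum_congr rfl fun _ _ =>
        Finset.sum_congr rfl fun _ _ => Finset.sum_congr rfl fun _ _ => ?_
      simp only [star_sub, star_mul']
      ring
    have h : ((∑ x, ∑ x', ∑ y, ∑ y',
        ‖M (x, y) * M (x', y') - M (x, y') * M (x', y)‖ ^ 2 : ℝ) : ℂ) = 0 := by
      push_cast
      simp only [← Complex.mul_conj']
      refine hzero.trans (by norm_num)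
    exact_mod_cast h
  simp only [← Fintype.sum_prod_type'] at hminors
  rw [Finset.sum_eq_zero_iff_of_nonneg fun _ _ => by positivity] at hminors
  simpa [sub_eq_zero] using hminors (x, x', y, y') (Finset.mem_univ _)

/-- For a four-partite pure state, if the reduced state on `A × B` is pure
(`tr ρ_AB² = 1`, i.e. `τ(AB|CD) = 0`), then the purities across the cuts `AC|BD`
and `AD|BC` coincide: `tr ρ_AC² = tr ρ_AD²`. -/
theorem purity_eq_of_pure_cut {A B C D : Type*}
    [Fintype A] [Fintype B] [Fintype C] [Fintype D]
    [Nonempty A] [Nonempty B] [Nonempty C] [Nonempty D]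
    (ψ : (A × B) × (C × D) → ℂ) (hψ : ∑ p, ‖ψ p‖ ^ 2 = 1)
    (ρ : Matrix ((A × B) × (C × D)) ((A × B) × (C × D)) ℂ)
    (hρ : ρ = Matrix.vecMulVec ψ (star ψ))
    (ρAB : Matrix (A × B) (A × B) ℂ)
    (hρAB : ∀ a b a' b',
      ρAB (a, b) (a', b') = ∑ c, ∑ d, ρ ((a, b), (c, d)) ((a', b'), (c, d)))
    (ρAC : Matrix (A × C) (A × C) ℂ)
    (hρAC : ∀ a c a' c',
      ρAC (a, c) (a', c') = ∑ b, ∑ d, ρ ((a, b), (c, d)) ((a', b), (c', d)))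
    (ρAD : Matrix (A × D) (A × D) ℂ)
    (hρAD : ∀ a d a' d',
      ρAD (a, d) (a', d') = ∑ b, ∑ c, ρ ((a, b), (c, d)) ((a', b), (c, d')))
    (hpure : Matrix.trace (ρAB * ρAB) = 1) :
    Matrix.trace (ρAC * ρAC) = Matrix.trace (ρAD * ρAD) := by
  have hswap := mul_eq_mul_swap_of_pure ψ hψ <| by
    rw [← hpure]
    simp only [Matrix.trace, Matrix.diag, Matrix.mul_apply]
    refine Finset.sum_congr rfl fun ⟨a, b⟩ _ => Finset.sum_congr rfl fun ⟨a', b'⟩ _ => ?_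
    simp only [hρAB, hρ, Matrix.vecMulVec_apply, Pi.star_apply, Fintype.sum_prod_type]
  simp only [Matrix.trace, Matrix.diag, Matrix.mul_apply, Fintype.sum_prod_type, hρAC, hρAD, hρ,
    Matrix.vecMulVec_apply, Pi.star_apply, Finset.sum_mul_sum]
  simp only [← Fintype.sum_prod_type']
  refine Finset.sum_nbij'
    (fun (a, c, a', c', b, b', d, d') => (a, d', a', d, b, b', c', c))
    (fun (a, d, a', d', b, b', c, c') => (a, c', a', c, b, b', d', d))
    (fun _ _ => Finset.mem_univ _) (fun _ _ => Finset.mem_univ _)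
    (fun _ _ => rfl) (fun _ _ => rfl) ?_
  rintro ⟨a, c, a', c', b, b', d, d'⟩ -
  linear_combination (star (ψ ((a', b), (c', d))) * star (ψ ((a, b'), (c, d')))) *
    hswap (a, b) (a', b') (c, d) (c', d')
end
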